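/- arXiv:1605.08165 — 2 statements merged into one kernel-verified Lean document; each statement's English description precedes it below -/
import Mathlib

section
/- Let β ≥ 2 be an integer, let f : ℝ^d → ℝ be convex and β-th order smooth with constant M_β, let δ > 0, and let k : [−1,1] → ℝ be a bounded measurable kernel satisfying E_r[r k(r)] = 1 and E_r[r^s k(r)] = 0 for every odd integer s with 3 ≤ s ≤ β, where r is uniform on [−1,1]. Then for every x ∈ ℝ^d, |f̂_δ(x) − f(x)| ≤ (M_β^β / β!) · δ^β · E_r[|k(r) r^{β+1}|]. -/
open MeasureTheory Metric

/-- The uniform probability distribution on the interval `[-1, 1] ⊆ ℝ`. -/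
noncomputable def intervalUniform : Measure ℝ :=
  (2 : ENNReal)⁻¹ • (volume.restrict (Set.Icc (-1 : ℝ) 1))

/-- The uniform probability distribution on the closed Euclidean unit ball of `ℝ^d`. -/
noncomputable def ballUniform (d : ℕ) : Measure (EuclideanSpace ℝ (Fin d)) :=
  (volume (closedBall (0 : EuclideanSpace ℝ (Fin d)) 1))⁻¹ •
    (volume.restrict (closedBall (0 : EuclideanSpace ℝ (Fin d)) 1))

/-- The smoothed version `f̂_δ` of `f : ℝ^d → ℝ`:
`f̂_δ(x) = E[f(x + r δ v) r k(r)]` where `r` is uniform on `[-1,1]` and `v` is independent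
of `r`, uniform on the closed unit ball. -/
noncomputable def smoothed (d : ℕ) (f : EuclideanSpace ℝ (Fin d) → ℝ) (δ : ℝ) (k : ℝ → ℝ)
    (x : EuclideanSpace ℝ (Fin d)) : ℝ :=
  ∫ p : ℝ × EuclideanSpace ℝ (Fin d), f (x + (p.1 * δ) • p.2) * (p.1 * k p.1)
    ∂(intervalUniform.prod (ballUniform d))

/-- `f : ℝ^d → ℝ` is `β`-th order smooth with constant `M`: it is `(β-1)`-times continuously
differentiable and its `(β-1)`-th directional derivatives are `M^β`-Lipschitz. -/
def HigherOrderSmooth (d β : ℕ) (M : ℝ) (f : EuclideanSpace ℝ (Fin d) → ℝ) : Prop :=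
  ContDiff ℝ (β - 1 : ℕ) f ∧
    ∀ (x y v : EuclideanSpace ℝ (Fin d)), ‖v‖ = 1 →
      |iteratedFDeriv ℝ (β - 1) f x (fun _ => v) - iteratedFDeriv ℝ (β - 1) f y (fun _ => v)|
        ≤ M ^ β * ‖x - y‖

/-- One-dimensional Taylor estimate for a chain of successive derivatives. -/
lemma taylor_chain (L : ℝ) (n : ℕ) : ∀ (g : ℕ → ℝ → ℝ),
    (∀ j < n, ∀ s, HasDerivAt (g j) (g (j + 1) s) s) →
    (∀ s, 0 ≤ s → |g n s - g n 0| ≤ L * s) →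
    ∀ s, 0 ≤ s → |g 0 s - ∑ j ∈ Finset.range (n + 1), s ^ j / (Nat.factorial j) * g j 0|
      ≤ L * s ^ (n + 1) / (Nat.factorial (n + 1)) := by
  induction n with
  | zero =>
    intro g _ h s hs
    simpa using h s hs
  | succ n ih =>
    intro g hg h s hs
    have h1 := ih (fun j => g (j + 1)) (fun j hj t => hg (j + 1) (by omega) t) h
    have hd : ∀ t : ℝ, HasDerivAt
        (fun s => g 0 s - ∑ j ∈ Finset.range (n + 1 + 1), s ^ j / (Nat.factorial j) * g j 0)
        (g 1 t - ∑ j ∈ Finset.range (n + 1), t ^ j / (Nat.factorial j) * g (j + 1) 0) t := by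
      intro t
      refine (hg 0 (by omega) t).sub ?_
      have : ∀ s : ℝ, ∑ j ∈ Finset.range (n + 1 + 1), s ^ j / (Nat.factorial j) * g j 0
          = ∑ j ∈ Finset.range (n + 1), s ^ (j + 1) / (Nat.factorial (j + 1)) * g (j + 1) 0
            + g 0 0 := by
        intro s
        rw [Finset.sum_range_succ']
        simp
      simp_rw [this]
      refine HasDerivAt.add_const _ ?_
      refine HasDerivAt.fun_sum fun j _ => ?_
      refine HasDerivAt.mul_const ?_ _
      have := (hasDerivAt_pow (j + 1) t).div_const ((Nat.factorial (j + 1) : ℕ) : ℝ)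
      refine this.congr_deriv ?_
      rw [Nat.factorial_succ, Nat.add_sub_cancel]
      have h2 : ((Nat.factorial j : ℕ) : ℝ) ≠ 0 := by positivity
      push_cast
      field_simp
    have hB : ∀ t : ℝ, HasDerivAt
        (fun s : ℝ => L * s ^ (n + 1 + 1) / (Nat.factorial (n + 1 + 1)))
        (L * t ^ (n + 1) / (Nat.factorial (n + 1))) t := by
      intro t
      have := ((hasDerivAt_pow (n + 1 + 1) t).const_mul L).div_const
        ((Nat.factorial (n + 1 + 1) : ℕ) : ℝ)
      refine this.congr_deriv ?_
      rw [Nat.factorial_succ (n + 1), Nat.add_sub_cancel]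
      have h2 : ((Nat.factorial (n + 1) : ℕ) : ℝ) ≠ 0 := by positivity
      push_cast
      field_simp
    have := image_norm_le_of_norm_deriv_right_le_deriv_boundary (a := 0) (b := s)
      (f := fun s => g 0 s - ∑ j ∈ Finset.range (n + 1 + 1), s ^ j / (Nat.factorial j) * g j 0)
      (fun t _ => (hd t).continuousAt.continuousWithinAt)
      (fun t _ => (hd t).hasDerivWithinAt)
      (B := fun s : ℝ => L * s ^ (n + 1 + 1) / (Nat.factorial (n + 1 + 1)))
      (by simp [Finset.sum_range_succ'])
      hB
      (fun t ht => h1 t ht.1)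
      (x := s) ⟨hs, le_rfl⟩
    exact this

lemma deriv_along {E : Type*} [NormedAddCommGroup E] [NormedSpace ℝ E] (f : E → ℝ) (n : ℕ)
    (hf : ContDiff ℝ n f) (x w : E) (j : ℕ) (hj : j < n) (s : ℝ) :
    HasDerivAt (fun s : ℝ => iteratedFDeriv ℝ j f (x + s • w) (fun _ => w))
      (iteratedFDeriv ℝ (j + 1) f (x + s • w) (fun _ => w)) s := by
  have h1 : DifferentiableAt ℝ (iteratedFDeriv ℝ j f) (x + s • w) :=
    (hf.differentiable_iteratedFDeriv (by exact_mod_cast hj)) _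
  have h2 : HasDerivAt (fun s : ℝ => x + s • w) w s := by
    simpa using ((hasDerivAt_id s).smul_const w).const_add x
  have h3 := h1.hasFDerivAt.comp_hasDerivAt s h2
  have h4 := ((ContinuousMultilinearMap.apply ℝ (fun _ : Fin j => E) ℝ
    (fun _ => w)).hasFDerivAt).comp_hasDerivAt s h3
  rw [iteratedFDeriv_succ_apply_left]
  exact h4

lemma taylor_bound (d β : ℕ) (hβ : 2 ≤ β) (f : EuclideanSpace ℝ (Fin d) → ℝ) (M : ℝ)
    (hs : HigherOrderSmooth d β M f) (x w : EuclideanSpace ℝ (Fin d)) :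
    |f (x + w) - ∑ j ∈ Finset.range β,
      (1 / (Nat.factorial j : ℝ)) * iteratedFDeriv ℝ j f x (fun _ => w)|
      ≤ M ^ β * ‖w‖ ^ β / (Nat.factorial β) := by
  obtain ⟨n, rfl⟩ : ∃ n, β = n + 1 := ⟨β - 1, by omega⟩
  obtain ⟨hf, hL⟩ := hs
  simp only [Nat.add_sub_cancel] at hf hL
  have key := taylor_chain (M ^ (n + 1) * ‖w‖ ^ (n + 1)) n
    (fun j s => iteratedFDeriv ℝ j f (x + s • w) (fun _ => w))
    (fun j hj s => deriv_along f n hf x w j hj s) ?_ 1 zero_le_one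
  · simpa using key
  · intro s hs
    by_cases hw : w = 0
    · subst hw
      simp
    have hw' : ‖w‖ ≠ 0 := by simpa using hw
    have hu : ‖(‖w‖⁻¹ • w)‖ = 1 := by
      rw [norm_smul, norm_inv, norm_norm, inv_mul_cancel₀ hw']
    have hh : ∀ y, iteratedFDeriv ℝ n f y (fun _ => w)
        = ‖w‖ ^ n * iteratedFDeriv ℝ n f y (fun _ => ‖w‖⁻¹ • w) := by
      intro y
      have := (iteratedFDeriv ℝ n f y).map_smul_univ (fun _ => ‖w‖) (fun _ => ‖w‖⁻¹ • w)
      simp only [smul_smul, mul_inv_cancel₀ hw', one_smul] at this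
      rw [this]
      simp
    have h := hL (x + s • w) (x + (0 : ℝ) • w) _ hu
    simp only [hh (x + s • w), hh (x + (0 : ℝ) • w)]
    rw [← mul_sub, abs_mul, abs_of_nonneg (by positivity : 0 ≤ ‖w‖ ^ n)]
    calc _ ≤ ‖w‖ ^ n * (M ^ (n + 1) * ‖x + s • w - (x + (0 : ℝ) • w)‖) :=
        mul_le_mul_of_nonneg_left h (by positivity)
      _ = _ := by
        simp [norm_smul, abs_of_nonneg hs]
        ring

instance : IsProbabilityMeasure intervalUniform := by
  constructor
  simp only [intervalUniform, Measure.smul_apply, Measure.restrict_apply_univ, Real.volume_Icc,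
    smul_eq_mul]
  norm_num
  exact ENNReal.inv_mul_cancel (by simp) (by simp)

instance (d : ℕ) : IsProbabilityMeasure (ballUniform d) := by
  constructor
  simp only [ballUniform, Measure.smul_apply, Measure.restrict_apply_univ, smul_eq_mul]
  refine ENNReal.inv_mul_cancel ?_ ?_
  · exact (measure_closedBall_pos _ _ one_pos).ne'
  · exact measure_closedBall_lt_top.ne

lemma ae_interval : ∀ᵐ r ∂intervalUniform, r ∈ Set.Icc (-1 : ℝ) 1 :=
  Measure.ae_smul_measure (ae_restrict_mem measurableSet_Icc) _

lemma ae_ball (d : ℕ) : ∀ᵐ v ∂(ballUniform d), v ∈ closedBall (0 : EuclideanSpace ℝ (Fin d)) 1 :=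
  Measure.ae_smul_measure (ae_restrict_mem measurableSet_closedBall) _

lemma ball_odd (d : ℕ) (a : EuclideanSpace ℝ (Fin d) → ℝ) (ha : ∀ v, a (-v) = - a v) :
    ∫ v, a v ∂(ballUniform d) = 0 := by
  rw [ballUniform, integral_smul_measure, ← integral_indicator measurableSet_closedBall]
  set F := (closedBall (0 : EuclideanSpace ℝ (Fin d)) 1).indicator a with hF
  have h1 : ∀ v, F (-v) = - F v := by
    intro v
    simp only [hF, Set.indicator, mem_closedBall, dist_zero_right, norm_neg, ha]
    split_ifs <;> simp
  have h2 := integral_neg_eq_self F volume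
  simp only [h1, integral_neg] at h2
  have : ∫ v, F v = 0 := by linarith
  rw [this, smul_zero]

theorem stmt_2 (d : ℕ) (hd : 1 ≤ d) (β : ℕ) (hβ : 2 ≤ β)
    (f : EuclideanSpace ℝ (Fin d) → ℝ) (hconv : ConvexOn ℝ Set.univ f)
    (Mβ : ℝ) (hMβ : 0 < Mβ) (hsmooth : HigherOrderSmooth d β Mβ f)
    (δ : ℝ) (hδ : 0 < δ)
    (k : ℝ → ℝ) (hkmeas : Measurable k) (hkbdd : ∃ C, ∀ r ∈ Set.Icc (-1 : ℝ) 1, |k r| ≤ C)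
    (hk1 : ∫ r, r * k r ∂intervalUniform = 1)
    (hkodd : ∀ s : ℕ, Odd s → 3 ≤ s → s ≤ β → ∫ r, r ^ s * k r ∂intervalUniform = 0) :
    ∀ x : EuclideanSpace ℝ (Fin d),
      |smoothed d f δ k x - f x| ≤
        Mβ ^ β / (Nat.factorial β) * δ ^ β * ∫ r, |k r * r ^ (β + 1)| ∂intervalUniform := by
  intro x
  obtain ⟨C, hC⟩ := hkbdd
  have hC0 : 0 ≤ C := (abs_nonneg _).trans (hC 0 (by simp))
  set μ := intervalUniform.prod (ballUniform d) with hμ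
  have haeμ : ∀ᵐ p ∂μ, p.1 ∈ Set.Icc (-1 : ℝ) 1 ∧
      p.2 ∈ closedBall (0 : EuclideanSpace ℝ (Fin d)) 1 := by
    have h1 : ∀ᵐ p ∂μ, p.1 ∈ Set.Icc (-1 : ℝ) 1 :=
      Measure.quasiMeasurePreserving_fst.ae ae_interval
    have h2 : ∀ᵐ p ∂μ, p.2 ∈ closedBall (0 : EuclideanSpace ℝ (Fin d)) 1 :=
      Measure.quasiMeasurePreserving_snd.ae (ae_ball d)
    filter_upwards [h1, h2] with p h1 h2 using ⟨h1, h2⟩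
  -- integrability of (continuous) * kernel on the product
  have hint : ∀ G : ℝ × EuclideanSpace ℝ (Fin d) → ℝ, Continuous G →
      Integrable (fun p => G p * (p.1 * k p.1)) μ := by
    intro G hG
    obtain ⟨D, hD⟩ := ((isCompact_Icc (a := (-1 : ℝ)) (b := 1)).prod
      (isCompact_closedBall (0 : EuclideanSpace ℝ (Fin d)) 1)).exists_bound_of_continuousOn
      hG.continuousOn
    refine Integrable.of_bound (C := D * (1 * C)) ?_ ?_
    · exact (hG.measurable.mul (measurable_fst.mul
        (hkmeas.comp measurable_fst))).aestronglyMeasurable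
    · filter_upwards [haeμ] with p hp
      have h1 := hD p ⟨hp.1, hp.2⟩
      have h2 := hC p.1 hp.1
      have h3 : |p.1| ≤ 1 := abs_le.2 hp.1
      rw [norm_mul, norm_mul, Real.norm_eq_abs p.1, Real.norm_eq_abs (k p.1)]
      have h4 : 0 ≤ D := (norm_nonneg _).trans h1
      gcongr
  have hfc : Continuous f := hsmooth.1.continuous
  set a : ℕ → EuclideanSpace ℝ (Fin d) → ℝ := fun j v => iteratedFDeriv ℝ j f x (fun _ => v)
    with ha
  have hac : ∀ j, Continuous (a j) := fun j =>
    (iteratedFDeriv ℝ j f x).cont.comp (continuous_pi fun _ => continuous_id)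
  have hsm : ∀ j (c : ℝ) v, a j (c • v) = c ^ j * a j v := by
    intro j c v
    have := (iteratedFDeriv ℝ j f x).map_smul_univ (fun _ => c) (fun _ => v)
    simpa [ha] using this
  set P : ℝ × EuclideanSpace ℝ (Fin d) → ℝ := fun p =>
    ∑ j ∈ Finset.range β, (1 / (Nat.factorial j : ℝ)) * a j ((p.1 * δ) • p.2) with hP
  have hPc : Continuous P := by
    refine continuous_finsetSum _ fun j _ => continuous_const.mul ((hac j).comp ?_)
    fun_prop
  have hGc : Continuous (fun p : ℝ × EuclideanSpace ℝ (Fin d) => f (x + (p.1 * δ) • p.2)) :=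
    hfc.comp (by fun_prop)
  -- the polynomial part integrates to `f x`
  have hterm : ∀ j, ∫ p, (1 / (Nat.factorial j : ℝ)) * a j ((p.1 * δ) • p.2) * (p.1 * k p.1) ∂μ
      = (δ ^ j / (Nat.factorial j : ℝ)) * ((∫ r, r ^ (j + 1) * k r ∂intervalUniform) *
        ∫ v, a j v ∂(ballUniform d)) := by
    intro j
    rw [hμ, ← integral_prod_mul, ← integral_const_mul]
    congr 1
    ext p
    rw [hsm]
    ring
  have hpoly : ∫ p, P p * (p.1 * k p.1) ∂μ = f x := by
    have h1 : ∀ p : ℝ × EuclideanSpace ℝ (Fin d), P p * (p.1 * k p.1) =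
        ∑ j ∈ Finset.range β,
          (1 / (Nat.factorial j : ℝ)) * a j ((p.1 * δ) • p.2) * (p.1 * k p.1) := by
      intro p
      rw [hP, Finset.sum_mul]
    simp_rw [h1]
    rw [integral_finsetSum]
    · rw [Finset.sum_eq_single 0]
      · rw [hterm]
        simp [ha, hk1]
      · intro j hj hj0
        rw [hterm]
        rw [Finset.mem_range] at hj
        rcases Nat.even_or_odd j with he | ho
        · have : 2 ≤ j := by
            rcases he with ⟨m, hm⟩
            omega
          rw [hkodd (j + 1) he.add_one (by omega) (by omega)]
          simp
        · rw [ball_odd d (a j)]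
          · simp
          · intro v
            have := hsm j (-1) v
            rw [ho.neg_one_pow] at this
            simpa using this
      · intro h
        exact absurd (Finset.mem_range.2 (by omega)) h
    · intro j _
      refine hint (fun p => (1 / (Nat.factorial j : ℝ)) * a j ((p.1 * δ) • p.2)) ?_
      exact continuous_const.mul ((hac j).comp (by fun_prop))
  have hdiff : smoothed d f δ k x - f x
      = ∫ p, (f (x + (p.1 * δ) • p.2) * (p.1 * k p.1) - P p * (p.1 * k p.1)) ∂μ := by
    rw [integral_sub (hint _ hGc) (hint _ hPc), hpoly]
    rfl
  rw [hdiff]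
  set K : ℝ := Mβ ^ β / (Nat.factorial β) * δ ^ β with hK
  have hK0 : 0 ≤ K := by positivity
  have hR : Integrable (fun r => |k r * r ^ (β + 1)|) intervalUniform := by
    refine Integrable.of_bound (C := C * 1) ?_ ?_
    · exact ((hkmeas.mul (measurable_id.pow_const _)).abs).aestronglyMeasurable
    · filter_upwards [ae_interval] with r hr
      rw [Real.norm_eq_abs, abs_abs, abs_mul, abs_pow]
      have h3 : |r| ≤ 1 := abs_le.2 hr
      have h4 := hC r hr
      have h5 : |r| ^ (β + 1) ≤ 1 := pow_le_one₀ (abs_nonneg _) h3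
      gcongr
  have hR2 : Integrable (fun p : ℝ × EuclideanSpace ℝ (Fin d) =>
      K * |k p.1 * p.1 ^ (β + 1)|) μ := (hR.comp_fst (ballUniform d)).const_mul K
  have hval : ∫ p, K * |k p.1 * p.1 ^ (β + 1)| ∂μ
      = K * ∫ r, |k r * r ^ (β + 1)| ∂intervalUniform := by
    rw [integral_const_mul, hμ, integral_fun_fst (fun r => |k r * r ^ (β + 1)|)]
    simp
  rw [← hval, ← Real.norm_eq_abs]
  refine norm_integral_le_of_norm_le hR2 ?_
  filter_upwards [haeμ] with p hp
  have hT := taylor_bound d β hβ f Mβ hsmooth x ((p.1 * δ) • p.2)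
  have hv : ‖p.2‖ ≤ 1 := by simpa using hp.2
  have hw : ‖(p.1 * δ) • p.2‖ ≤ |p.1| * δ := by
    rw [norm_smul, Real.norm_eq_abs, abs_mul, abs_of_pos hδ]
    exact mul_le_of_le_one_right (by positivity) hv
  rw [← sub_mul, Real.norm_eq_abs, abs_mul, abs_mul p.1]
  calc _ ≤ (Mβ ^ β * (|p.1| * δ) ^ β / (Nat.factorial β)) * (|p.1| * |k p.1|) := by
        refine mul_le_mul_of_nonneg_right (hT.trans ?_) (by positivity)
        gcongr
    _ = _ := by
        rw [abs_mul, abs_pow, hK]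
        ring
end

section
/- Let d ≥ 1 and let f : ℝ^d → ℝ be continuous. Define F(x) = E[f(x + v)], where v is uniformly distributed on the closed Euclidean unit ball of ℝ^d. Then F is differentiable on ℝ^d and, for every x ∈ ℝ^d, ∇F(x) = d · E[f(x + u) u], where u is uniformly distributed on the Euclidean unit sphere of ℝ^d (normalized surface measure). -/
open MeasureTheory Metric

/-- The uniform probability distribution (normalized surface measure) on the Euclidean
unit sphere of `ℝ^d`, viewed as a measure on `ℝ^d`. -/
noncomputable def sphereUniform (d : ℕ) : Measure (EuclideanSpace ℝ (Fin d)) :=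
  ((volume : Measure (EuclideanSpace ℝ (Fin d))).toSphere Set.univ)⁻¹ •
    ((volume : Measure (EuclideanSpace ℝ (Fin d))).toSphere.map Subtype.val)

section aux

set_option linter.unusedSectionVars false

open Set Filter Topology

variable {E : Type*} [NormedAddCommGroup E] [InnerProductSpace ℝ E] [FiniteDimensional ℝ E]
  [MeasurableSpace E] [BorelSpace E]

lemma polar_integral [Nontrivial E] (μ : Measure E) [μ.IsAddHaarMeasure]
    {F : Type*} [NormedAddCommGroup F] [NormedSpace ℝ F]
    (g : E → F) (hg : Integrable g μ) :
    ∫ x, g x ∂μ = ∫ r in Ioi (0 : ℝ), r ^ (Module.finrank ℝ E - 1) •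
      ∫ u : sphere (0 : E) 1, g (r • (u : E)) ∂μ.toSphere := by
  have hmp := μ.measurePreserving_homeomorphUnitSphereProd
  have hemb := (homeomorphUnitSphereProd E).measurableEmbedding
  have hcomp : ∀ x : ({0}ᶜ : Set E), g x.1 =
      (fun p : sphere (0 : E) 1 × Ioi (0 : ℝ) => g (p.2.1 • p.1.1)) (homeomorphUnitSphereProd E x) := by
    intro x
    have := congrArg Subtype.val ((homeomorphUnitSphereProd E).symm_apply_apply x)
    rw [homeomorphUnitSphereProd_symm_apply_coe] at this
    simp only [this]
  have hint : Integrable (fun p : sphere (0 : E) 1 × Ioi (0 : ℝ) => g (p.2.1 • p.1.1))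
      (μ.toSphere.prod (.volumeIoiPow (Module.finrank ℝ E - 1))) := by
    rw [← hmp.integrable_comp_emb hemb]
    have h1 : IntegrableOn g ({0}ᶜ : Set E) μ := hg.integrableOn
    rw [integrableOn_iff_comap_subtypeVal (measurableSet_singleton _).compl] at h1
    refine h1.congr (Eventually.of_forall fun x => ?_)
    exact hcomp x
  calc ∫ x, g x ∂μ = ∫ x : ({(0)}ᶜ : Set E), g x.1 ∂(μ.comap (↑)) := by
        rw [integral_subtype_comap (measurableSet_singleton _).compl g,
          restrict_compl_singleton]
    _ = ∫ p : sphere (0 : E) 1 × Ioi (0 : ℝ), g (p.2.1 • p.1.1)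
        ∂μ.toSphere.prod (.volumeIoiPow (Module.finrank ℝ E - 1)) := by
        rw [← hmp.integral_comp hemb]
        exact integral_congr_ae (Eventually.of_forall hcomp)
    _ = ∫ r : Ioi (0 : ℝ), ∫ u : sphere (0 : E) 1, g (r.1 • (u : E)) ∂μ.toSphere
        ∂(Measure.volumeIoiPow (Module.finrank ℝ E - 1)) := by
        rw [integral_prod_symm _ hint]
    _ = _ := by
      simp only [Measure.volumeIoiPow, ENNReal.ofReal]
      rw [integral_withDensity_eq_integral_smul,
        integral_subtype_comap measurableSet_Ioi
          fun a ↦ Real.toNNReal (a ^ (Module.finrank ℝ E - 1)) •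
            ∫ u : sphere (0 : E) 1, g (a • (u : E)) ∂μ.toSphere,
        setIntegral_congr_fun measurableSet_Ioi fun x hx ↦ ?_]
      · simp only [NNReal.smul_def]
        rw [Real.coe_toNNReal _ (pow_nonneg (le_of_lt hx) _)]
      · exact (measurable_subtype_coe.pow_const _).real_toNNReal

/-- smooth cutoff profile (as a function of the squared norm) -/
noncomputable def prof (n : ℕ) (t : ℝ) : ℝ := Real.smoothTransition (1 + (n + 1) * (1 - t))

noncomputable def dprof (n : ℕ) (t : ℝ) : ℝ :=
  (n + 1) * deriv Real.smoothTransition (1 + (n + 1) * (1 - t))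

lemma contDiff_prof (n : ℕ) : ContDiff ℝ 1 (prof n) := by
  unfold prof
  exact (Real.smoothTransition.contDiff (n := 1)).comp (by fun_prop)

lemma hasDerivAt_prof (n : ℕ) (t : ℝ) : HasDerivAt (prof n) (-dprof n t) t := by
  have h1 : HasDerivAt Real.smoothTransition
      (deriv Real.smoothTransition (1 + (n + 1) * (1 - t))) (1 + (n + 1) * (1 - t)) :=
    ((Real.smoothTransition.contDiff (n := 1)).differentiable (by simp) _).hasDerivAt
  have h2 : HasDerivAt (fun t : ℝ => 1 + ((n : ℝ) + 1) * (1 - t)) (-(n + 1)) t := by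
    have := (((hasDerivAt_id t).const_sub 1).const_mul ((n : ℝ) + 1)).const_add 1
    simpa using this
  have := h1.comp t h2
  refine this.congr_deriv ?_
  simp [dprof]; ring

lemma continuous_dprof (n : ℕ) : Continuous (dprof n) := by
  have h1 : Continuous (deriv Real.smoothTransition) :=
    (Real.smoothTransition.contDiff (n := 1)).continuous_deriv (by simp)
  unfold dprof
  fun_prop

lemma dprof_nonneg (n : ℕ) (t : ℝ) : 0 ≤ dprof n t := by
  have := Real.smoothTransition.monotone.deriv_nonneg (x := 1 + (n + 1) * (1 - t))
  unfold dprof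
  positivity

lemma prof_eq_one (n : ℕ) {t : ℝ} (h : t ≤ 1) : prof n t = 1 := by
  apply Real.smoothTransition.one_of_one_le
  have : 0 ≤ ((n : ℝ) + 1) * (1 - t) := mul_nonneg (by positivity) (by linarith)
  linarith

lemma prof_eq_zero (n : ℕ) {t : ℝ} (h : 1 + 1 / ((n : ℝ) + 1) ≤ t) : prof n t = 0 := by
  apply Real.smoothTransition.zero_of_nonpos
  have hn : (0 : ℝ) < (n : ℝ) + 1 := by positivity
  have : ((n : ℝ) + 1) * (1 - t) ≤ ((n : ℝ) + 1) * (-(1 / ((n : ℝ) + 1))) :=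
    mul_le_mul_of_nonneg_left (by linarith) hn.le
  have h3 : ((n : ℝ) + 1) * (-(1 / ((n : ℝ) + 1))) = -1 := by field_simp
  linarith

lemma dprof_eq_zero_of_lt (n : ℕ) {t : ℝ} (h : t < 1) : dprof n t = 0 := by
  have h1 := hasDerivAt_prof n t
  have h2 : HasDerivAt (prof n) 0 t := by
    refine (hasDerivAt_const t (1 : ℝ)).congr_of_eventuallyEq ?_
    filter_upwards [Iio_mem_nhds h] with s hs using prof_eq_one n (le_of_lt hs)
  simpa using h1.unique h2

lemma dprof_eq_zero_of_gt (n : ℕ) {t : ℝ} (h : 1 + 1 / ((n : ℝ) + 1) < t) : dprof n t = 0 := by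
  have h1 := hasDerivAt_prof n t
  have h2 : HasDerivAt (prof n) 0 t := by
    refine (hasDerivAt_const t (0 : ℝ)).congr_of_eventuallyEq ?_
    filter_upwards [Ioi_mem_nhds h] with s hs using prof_eq_zero n (le_of_lt hs)
  simpa using h1.unique h2

lemma one_div_succ_le_one (n : ℕ) : 1 / ((n : ℝ) + 1) ≤ 1 := by
  rw [div_le_one (by positivity)]; linarith [n.cast_nonneg (α := ℝ)]

/-- the radial kernel -/
noncomputable def radKer (n : ℕ) (r : ℝ) : ℝ := 2 * r * dprof n (r ^ 2)

lemma hasDerivAt_ker (n : ℕ) (r : ℝ) :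
    HasDerivAt (fun r => - prof n (r ^ 2)) (radKer n r) r := by
  have := ((hasDerivAt_prof n (r ^ 2)).comp r (hasDerivAt_pow 2 r)).neg
  refine this.congr_deriv ?_
  simp [radKer]; ring

lemma ker_nonneg (n : ℕ) {r : ℝ} (hr : 0 < r) : 0 ≤ radKer n r := by
  have := dprof_nonneg n (r ^ 2)
  unfold radKer; positivity

lemma tendsto_prof (n : ℕ) : Tendsto (fun r : ℝ => - prof n (r ^ 2)) atTop (𝓝 0) := by
  refine tendsto_const_nhds.congr' ?_
  filter_upwards [eventually_ge_atTop 2] with r hr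
  rw [prof_eq_zero, neg_zero]
  nlinarith [one_div_succ_le_one n]

lemma integrableOn_ker (n : ℕ) : IntegrableOn (radKer n) (Ioi 0) :=
  integrableOn_Ioi_deriv_of_nonneg' (fun r _ => hasDerivAt_ker n r)
    (fun _ hr => ker_nonneg n hr) (tendsto_prof n)

lemma integral_ker (n : ℕ) : ∫ r in Ioi (0 : ℝ), radKer n r = 1 := by
  rw [integral_Ioi_of_hasDerivAt_of_nonneg' (fun r _ => hasDerivAt_ker n r)
    (fun _ hr => ker_nonneg n hr) (tendsto_prof n)]
  simp [prof_eq_one]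

lemma continuous_ker (n : ℕ) : Continuous (radKer n) := by
  have := continuous_dprof n
  unfold radKer; fun_prop

lemma ker_ne_zero (n : ℕ) {r : ℝ} (hr : 0 < r) (h : radKer n r ≠ 0) :
    r ∈ Icc 1 (1 + 1 / ((n : ℝ) + 1)) := by
  have hn : 0 < 1 / ((n : ℝ) + 1) := by positivity
  constructor
  · by_contra! h1
    exact h (by rw [radKer, dprof_eq_zero_of_lt n (by nlinarith), mul_zero])
  · by_contra! h1
    exact h (by rw [radKer, dprof_eq_zero_of_gt n (by nlinarith), mul_zero])

lemma contDiff_bump (n : ℕ) : ContDiff ℝ 1 (fun v : E => prof n (‖v‖ ^ 2)) :=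
  (contDiff_prof n).comp (contDiff_norm_sq ℝ)

lemma bump_zero (n : ℕ) (v : E) (hv : v ∉ closedBall (0 : E) 2) : prof n (‖v‖ ^ 2) = 0 := by
  rw [mem_closedBall_zero_iff, not_le] at hv
  apply prof_eq_zero
  nlinarith [one_div_succ_le_one n]

lemma dbump_zero (n : ℕ) (v : E) (hv : v ∉ closedBall (0 : E) 2) : dprof n (‖v‖ ^ 2) = 0 := by
  rw [mem_closedBall_zero_iff, not_le] at hv
  apply dprof_eq_zero_of_gt
  nlinarith [one_div_succ_le_one n]

lemma hasFDerivAt_bump (n : ℕ) (v : E) :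
    HasFDerivAt (fun v : E => prof n (‖v‖ ^ 2)) (-((2 * dprof n (‖v‖ ^ 2)) • innerSL ℝ v)) v := by
  have h := (hasDerivAt_prof n (‖v‖ ^ 2)).comp_hasFDerivAt v (hasStrictFDerivAt_norm_sq v).hasFDerivAt
  refine h.congr_fderiv ?_
  ext w
  simp; ring

lemma hasFDerivAt_smoothed (μ : Measure E) [μ.IsAddHaarMeasure] (f : E → ℝ) (hf : Continuous f)
    (n : ℕ) (x : E) :
    HasFDerivAt (fun y => ∫ v, prof n (‖v‖ ^ 2) * f (y + v) ∂μ)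
      (innerSL ℝ (∫ v, (2 * dprof n (‖v‖ ^ 2) * f (x + v)) • v ∂μ)) x := by
  have hcs : HasCompactSupport (fun v : E => prof n (‖v‖ ^ 2)) :=
    HasCompactSupport.intro (isCompact_closedBall (0 : E) 2) (bump_zero n)
  have h := hcs.hasFDerivAt_convolution_right (μ := μ) (ContinuousLinearMap.lsmul ℝ ℝ)
    hf.locallyIntegrable (contDiff_bump n) x
  have e1 : (fun y => ∫ v, prof n (‖v‖ ^ 2) * f (y + v) ∂μ) =
      (convolution f (fun v : E => prof n (‖v‖ ^ 2)) (ContinuousLinearMap.lsmul ℝ ℝ) μ) := by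
    ext y
    rw [convolution_def, ← integral_add_left_eq_self (fun t => (ContinuousLinearMap.lsmul ℝ ℝ (f t)) (prof n (‖y - t‖ ^ 2))) y]
    refine integral_congr_ae (Eventually.of_forall fun v => ?_)
    simp [mul_comm]
  rw [e1]
  refine h.congr_fderiv ?_
  have hdc := continuous_dprof n
  rw [convolution_def, ← integral_add_left_eq_self _ x, ← ContinuousLinearMap.integral_comp_comm]
  · refine integral_congr_ae (Eventually.of_forall fun v => ?_)
    simp only [(hasFDerivAt_bump n _).fderiv]
    ext w
    simp [ContinuousLinearMap.precompR_apply]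
    ring_nf
    rfl
  · refine Continuous.integrable_of_hasCompactSupport (by fun_prop) ?_
    refine HasCompactSupport.intro (isCompact_closedBall (0 : E) 2) fun v hv => ?_
    simp [dbump_zero n v hv]

/-- spherical vector mean -/
noncomputable def smean (μ : Measure E) (f : E → ℝ) (r : ℝ) (y : E) : E :=
  r ^ (Module.finrank ℝ E - 1) • ∫ u : sphere (0 : E) 1, f (y + r • (u : E)) • (u : E) ∂μ.toSphere

lemma continuous_smean (μ : Measure E) [μ.IsAddHaarMeasure] (f : E → ℝ) (hf : Continuous f) :
    Continuous (Function.uncurry (smean μ f)) := by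
  have := continuous_parametric_integral_of_continuous (μ := μ.toSphere) (X := ℝ × E)
    (f := fun p (u : sphere (0 : E) 1) => f (p.2 + p.1 • (u : E)) • (u : E))
    (by simp only [Function.uncurry_def]; fun_prop) (s := univ) isCompact_univ
  simp only [Measure.restrict_univ] at this
  unfold smean
  simp only [Function.uncurry_def]
  exact (continuous_fst.pow _).smul this

lemma polar_smoothed [Nontrivial E] (μ : Measure E) [μ.IsAddHaarMeasure] (f : E → ℝ)
    (hf : Continuous f) (n : ℕ) (x : E) :
    ∫ v, (2 * dprof n (‖v‖ ^ 2) * f (x + v)) • v ∂μ =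
      ∫ r in Ioi (0 : ℝ), radKer n r • smean μ f r x := by
  have hdc := continuous_dprof n
  rw [polar_integral μ (fun v : E => (2 * dprof n (‖v‖ ^ 2) * f (x + v)) • v)]
  · refine setIntegral_congr_fun measurableSet_Ioi fun r hr => ?_
    have hr' : 0 < r := hr
    simp only [smean]
    rw [smul_comm (radKer n r), ← integral_smul (radKer n r)
      (fun u : sphere (0 : E) 1 => f (x + r • (u : E)) • (u : E))]
    congr 1
    refine integral_congr_ae (Eventually.of_forall fun (u : sphere (0 : E) 1) => ?_)
    simp only [norm_smul, norm_eq_of_mem_sphere, Real.norm_eq_abs, mul_one, sq_abs, smul_smul, radKer]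
    congr 1
    ring
  · refine Continuous.integrable_of_hasCompactSupport (by fun_prop) ?_
    refine HasCompactSupport.intro (isCompact_closedBall (0 : E) 2) fun v hv => ?_
    simp [dbump_zero n v hv]

lemma tendsto_smoothed [Nontrivial E] (μ : Measure E) [μ.IsAddHaarMeasure] (f : E → ℝ)
    (hf : Continuous f) (x : E) :
    TendstoUniformlyOn (fun n y => innerSL ℝ (∫ v, (2 * dprof n (‖v‖ ^ 2) * f (y + v)) • v ∂μ))
      (fun y => innerSL ℝ (smean μ f 1 y)) atTop (ball x 1) := by
  have hc := continuous_smean μ f hf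
  rw [Metric.tendstoUniformlyOn_iff]
  intro ε hε
  obtain ⟨V, hV, hV2⟩ := (isCompact_closedBall x 1).mem_uniformity_of_prod (q := (1 : ℝ))
    (hc.continuousOn (s := univ ×ˢ closedBall x 1)) (mem_univ _) (dist_mem_uniformity (half_pos hε))
  rw [nhdsWithin_univ] at hV
  obtain ⟨δ, hδ, hδV⟩ := Metric.mem_nhds_iff.1 hV
  have ht := (tendsto_one_div_add_atTop_nhds_zero_nat (𝕜 := ℝ)).eventually (gt_mem_nhds hδ)
  filter_upwards [ht] with n hn y hy
  rw [dist_comm, dist_eq_norm, ← map_sub, innerSL_apply_norm, polar_smoothed μ f hf]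
  have hone : smean μ f 1 y = ∫ r in Ioi (0 : ℝ), radKer n r • smean μ f 1 y := by
    rw [integral_smul_const, integral_ker, one_smul]
  have hker := continuous_ker n
  have hcy : Continuous (fun r => smean μ f r y) := hc.comp (by fun_prop : Continuous fun r : ℝ => (r, y))
  have hi1 : IntegrableOn (fun r => radKer n r • smean μ f 1 y) (Ioi 0) :=
    (integrableOn_ker n).smul_const _
  have hbd : ∀ r ∈ Ioi (0 : ℝ),
      ‖radKer n r • smean μ f r y - radKer n r • smean μ f 1 y‖ ≤ radKer n r * (ε / 2) := by
    intro r hr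
    rw [← smul_sub, norm_smul, Real.norm_of_nonneg (ker_nonneg n hr)]
    by_cases h0 : radKer n r = 0
    · simp [h0]
    · have hm := ker_ne_zero n hr h0
      refine mul_le_mul_of_nonneg_left ?_ (ker_nonneg n hr)
      have : r ∈ V := hδV (by
        rw [Metric.mem_ball, Real.dist_eq, abs_of_nonneg (by linarith [hm.1])]; linarith [hm.2])
      have := hV2 r this y (ball_subset_closedBall hy)
      simp only [mem_ofPred_eq, dist_eq_norm] at this
      exact this.le
  have hid : IntegrableOn (fun r => radKer n r • smean μ f r y - radKer n r • smean μ f 1 y) (Ioi 0) := by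
    refine Integrable.mono' ((integrableOn_ker n).mul_const (ε / 2)) ?_ ?_
    · exact Continuous.aestronglyMeasurable (by fun_prop)
    · exact (ae_restrict_iff' measurableSet_Ioi).2 (Eventually.of_forall hbd)
  have hi2 : IntegrableOn (fun r => radKer n r • smean μ f r y) (Ioi 0) := by
    refine (hid.add hi1).congr (Eventually.of_forall fun r => ?_)
    simp
  rw [hone, ← integral_sub hi2 hi1]
  calc _ ≤ ∫ r in Ioi (0 : ℝ), radKer n r * (ε / 2) :=
        norm_integral_le_of_norm_le ((integrableOn_ker n).mul_const (ε / 2))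
          ((ae_restrict_iff' measurableSet_Ioi).2 (Eventually.of_forall hbd))
    _ = ε / 2 := by rw [integral_mul_const, integral_ker, one_mul]
    _ < ε := half_lt_self hε

lemma tendsto_value (μ : Measure E) [μ.IsAddHaarMeasure] (f : E → ℝ)
    (hf : Continuous f) (y : E) :
    Tendsto (fun n : ℕ => ∫ v, prof n (‖v‖ ^ 2) * f (y + v) ∂μ) atTop
      (𝓝 (∫ v in closedBall (0 : E) 1, f (y + v) ∂μ)) := by
  rw [← integral_indicator measurableSet_closedBall]
  refine tendsto_integral_of_dominated_convergence
    ((closedBall (0 : E) 2).indicator fun v => ‖f (y + v)‖) ?_ ?_ ?_ ?_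
  · intro n
    have := (contDiff_bump (E := E) n).continuous
    exact Continuous.aestronglyMeasurable (by fun_prop)
  · rw [integrable_indicator_iff measurableSet_closedBall]
    exact ContinuousOn.integrableOn_compact (isCompact_closedBall _ _)
      (by fun_prop)
  · intro n
    refine Eventually.of_forall fun v => ?_
    by_cases hv : v ∈ closedBall (0 : E) 2
    · rw [indicator_of_mem hv, norm_mul]
      refine mul_le_of_le_one_left (norm_nonneg _) ?_
      rw [prof, Real.norm_of_nonneg (Real.smoothTransition.nonneg _)]
      exact Real.smoothTransition.le_one _
    · simp [indicator_of_notMem hv, bump_zero n v hv]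
  · refine Eventually.of_forall fun v => ?_
    by_cases hv : v ∈ closedBall (0 : E) 1
    · rw [indicator_of_mem hv]
      rw [mem_closedBall_zero_iff] at hv
      refine tendsto_const_nhds.congr fun n => ?_
      rw [prof_eq_one n (by nlinarith [norm_nonneg v]), one_mul]
    · rw [indicator_of_notMem hv]
      rw [mem_closedBall_zero_iff, not_le] at hv
      refine tendsto_const_nhds.congr' ?_
      have ht := (tendsto_one_div_add_atTop_nhds_zero_nat (𝕜 := ℝ)).eventually
        (gt_mem_nhds (sub_pos.2 hv))
      filter_upwards [ht] with n hn
      rw [prof_eq_zero n (by nlinarith), zero_mul]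

lemma hasFDerivAt_ball [Nontrivial E] (μ : Measure E) [μ.IsAddHaarMeasure] (f : E → ℝ)
    (hf : Continuous f) (x : E) :
    HasFDerivAt (fun y => ∫ v in closedBall (0 : E) 1, f (y + v) ∂μ)
      (innerSL ℝ (smean μ f 1 x)) x :=
  hasFDerivAt_of_tendstoUniformlyOn (g' := fun y => innerSL ℝ (smean μ f 1 y)) isOpen_ball
    (tendsto_smoothed μ f hf x)
    (fun n y _ => hasFDerivAt_smoothed μ f hf n y) (fun y _ => tendsto_value μ f hf y)
    (mem_ball_self one_pos)

end aux

theorem stmt_4 (d : ℕ) (hd : 1 ≤ d) (f : EuclideanSpace ℝ (Fin d) → ℝ)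
    (hf : Continuous f) :
    ∀ x : EuclideanSpace ℝ (Fin d),
      HasGradientAt (fun y => ∫ v, f (y + v) ∂(ballUniform d))
        ((d : ℝ) • ∫ u, f (x + u) • u ∂(sphereUniform d)) x := by
  intro x
  have : NeZero d := ⟨by omega⟩
  have : Nonempty (Fin d) := ⟨0⟩
  have h := (hasFDerivAt_ball volume f hf x).const_smul
    ((volume (closedBall (0 : EuclideanSpace ℝ (Fin d)) 1))⁻¹.toReal)
  rw [hasGradientAt_iff_hasFDerivAt]
  simp only [ballUniform, integral_smul_measure]
  refine h.congr_fderiv ?_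
  have hd0 : (d : ℝ) ≠ 0 := by positivity
  have key : (d : ℝ) • ∫ u, f (x + u) • u ∂(sphereUniform d) =
      (volume (closedBall (0 : EuclideanSpace ℝ (Fin d)) 1))⁻¹.toReal • smean volume f 1 x := by
    have hemb : MeasurableEmbedding (Subtype.val : sphere (0 : EuclideanSpace ℝ (Fin d)) 1 → _) :=
      MeasurableEmbedding.subtype_coe isClosed_sphere.measurableSet
    rw [sphereUniform, integral_smul_measure, hemb.integral_map, smul_smul, smean,
      Measure.toSphere_apply_univ, finrank_euclideanSpace_fin, one_pow, one_smul,
      ← Measure.addHaar_closedBall_eq_addHaar_ball]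
    simp only [one_smul, ENNReal.toReal_inv, ENNReal.toReal_mul, ENNReal.toReal_natCast]
    congr 1
    field_simp
  rw [key]
  ext w
  simp [InnerProductSpace.toDual_apply_apply]
end
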